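/- Let U and V be independent random variables, each uniformly distributed on [0,1]. Then the random variable Q₀ := U²(1 − V²) has probability density function d(z) = arctan(√(1−z)/√z) / (2√z) for z ∈ (0,1) (with respect to Lebesgue measure). -/

import Mathlib

open Real MeasureTheory ProbabilityTheory Set

/-- The density `d(z) = arctan(√(1−z)/√z)/(2√z)` on `(0,1)` (and `0` elsewhere). -/
noncomputable def d (z : ℝ) : ℝ :=
  Set.indicator (Set.Ioo 0 1)
    (fun z => Real.arctan (Real.sqrt (1 - z) / Real.sqrt z) / (2 * Real.sqrt z)) z

/-- The joint kernel: density of `u²(1-V²)` at `z`. -/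
noncomputable def kerQ (u z : ℝ) : ENNReal :=
  if 0 < z ∧ z < u ^ 2 then ENNReal.ofReal (1 / (2 * u * √(u ^ 2 - z))) else 0

lemma measurable_kerQ : Measurable (Function.uncurry kerQ) := by
  unfold kerQ Function.uncurry
  refine Measurable.ite ?_ ?_ measurable_const
  · exact (measurableSet_lt measurable_const measurable_snd).inter
      (measurableSet_lt measurable_snd (by fun_prop))
  · fun_prop

lemma measurable_kerQ_left (z : ℝ) : Measurable fun u => kerQ u z :=
  measurable_kerQ.comp (measurable_id.prodMk measurable_const)

lemma inner_v (u : ℝ) (hu : u ∈ Ioo (0:ℝ) 1) (f : ℝ → ENNReal) :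
    ∫⁻ v in Icc (0:ℝ) 1, f (u ^ 2 * (1 - v ^ 2)) = ∫⁻ z, kerQ u z * f z := by
  obtain ⟨hu0, hu1⟩ := hu
  have hu2 : 0 < u ^ 2 := by positivity
  rw [setLIntegral_congr (Ioo_ae_eq_Icc (a := (0:ℝ)) (b := 1)).symm]
  have himg : (fun z : ℝ => √(1 - z / u ^ 2)) '' Ioo 0 (u ^ 2) = Ioo 0 1 := by
    ext v
    constructor
    · rintro ⟨z, ⟨h0, h1⟩, rfl⟩
      have a1 : z / u ^ 2 < 1 := by rw [div_lt_one hu2]; exact h1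
      have a0 : 0 < z / u ^ 2 := by positivity
      refine ⟨Real.sqrt_pos.2 (by linarith), ?_⟩
      rw [Real.sqrt_lt' one_pos]; linarith
    · rintro ⟨h0, h1⟩
      have h2 : 0 < v ^ 2 := by positivity
      have h3 : v ^ 2 < 1 := by nlinarith
      refine ⟨u ^ 2 * (1 - v ^ 2), ⟨mul_pos hu2 (by linarith), by nlinarith⟩, ?_⟩
      have : 1 - u ^ 2 * (1 - v ^ 2) / u ^ 2 = v ^ 2 := by field_simp; ring
      simp only [this]
      exact Real.sqrt_sq h0.le
  have hpos : ∀ z ∈ Ioo 0 (u ^ 2), 0 < 1 - z / u ^ 2 := by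
    rintro z ⟨h0, h1⟩
    have a1 : z / u ^ 2 < 1 := by rw [div_lt_one hu2]; exact h1
    linarith
  have hsq : ∀ z ∈ Ioo 0 (u ^ 2), √(1 - z / u ^ 2) = √(u ^ 2 - z) / u := by
    rintro z hz
    have : 1 - z / u ^ 2 = (u ^ 2 - z) / u ^ 2 := by field_simp
    rw [this, Real.sqrt_div (by linarith [hz.2]), Real.sqrt_sq hu0.le]
  have hder : ∀ z ∈ Ioo 0 (u ^ 2), HasDerivWithinAt (fun z : ℝ => √(1 - z / u ^ 2))
      (-(1 / u ^ 2) / (2 * √(1 - z / u ^ 2))) (Ioo 0 (u ^ 2)) z := by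
    intro z hz
    have h1 : HasDerivAt (fun z : ℝ => 1 - z / u ^ 2) (-(1 / u ^ 2)) z :=
      ((hasDerivAt_id z).div_const (u ^ 2)).const_sub 1
    exact (h1.sqrt (hpos z hz).ne').hasDerivWithinAt
  have hinj : InjOn (fun z : ℝ => √(1 - z / u ^ 2)) (Ioo 0 (u ^ 2)) := by
    intro a ha b hb hab
    have := (Real.sqrt_inj (hpos a ha).le (hpos b hb).le).1 hab
    field_simp at this
    linarith
  rw [← himg, lintegral_image_eq_lintegral_abs_deriv_mul measurableSet_Ioo hder hinj,
    ← lintegral_indicator measurableSet_Ioo]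
  congr 1
  ext z
  by_cases hz : z ∈ Ioo 0 (u ^ 2)
  · rw [indicator_of_mem hz, kerQ, if_pos (by exact hz)]
    have hs : 0 < √(u ^ 2 - z) := Real.sqrt_pos.2 (by linarith [hz.2])
    congr 2
    · rw [hsq z hz, neg_div, abs_neg, abs_of_pos (by positivity)]
      field_simp
    · rw [Real.sq_sqrt (hpos z hz).le]
      field_simp
      ring
  · rw [indicator_of_notMem hz, kerQ, if_neg (by exact hz), zero_mul]

lemma inner_u (z : ℝ) :
    ∫⁻ u in Ioo (0:ℝ) 1, kerQ u z = ENNReal.ofReal (d z) := by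
  by_cases hz : z ∈ Ioo (0:ℝ) 1
  swap
  · rw [d, indicator_of_notMem hz, ENNReal.ofReal_zero, lintegral_eq_zero_iff'
      (measurable_kerQ_left z).aemeasurable]
    filter_upwards [ae_restrict_mem measurableSet_Ioo] with u hu
    rw [kerQ, if_neg]; rfl
    rintro ⟨h0, h1⟩
    exact hz ⟨h0, by nlinarith [hu.1, hu.2]⟩
  · obtain ⟨h0, h1⟩ := id hz
    have hs : 0 < √z := Real.sqrt_pos.2 h0
    have hs1 : √z < 1 := by rw [Real.sqrt_lt' one_pos]; linarith
    have hss : √z ^ 2 = z := Real.sq_sqrt h0.le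
    set G : ℝ → ℝ := fun u => 1 / (2 * u * √(u ^ 2 - z)) with hG
    set F : ℝ → ℝ := fun u => Real.arctan (√(u ^ 2 - z) / √z) / (2 * √z) with hF
    have hcont : ContinuousOn F (Icc (√z) 1) := by
      apply Continuous.continuousOn
      have : Continuous fun u : ℝ => √(u ^ 2 - z) / √z := by fun_prop
      exact (Real.continuous_arctan.comp this).div_const _
    have hlt : ∀ u ∈ Ioo (√z) 1, 0 < u ^ 2 - z := fun u hu => by nlinarith [hu.1]
    have hder : ∀ u ∈ Ioo (√z) 1, HasDerivAt F (G u) u := by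
      intro u hu
      have hp := hlt u hu
      have hu0 : 0 < u := hs.trans hu.1
      have hq : 0 < √(u ^ 2 - z) := Real.sqrt_pos.2 hp
      have e1 : HasDerivAt (fun u : ℝ => u ^ 2 - z) (2 * u) u := by
        simpa using (hasDerivAt_pow 2 u).sub_const z
      have e2 := (((e1.sqrt hp.ne').div_const (√z)).arctan).div_const (2 * √z)
      refine e2.congr_deriv ?_
      have : 1 + (√(u ^ 2 - z) / √z) ^ 2 = u ^ 2 / z := by
        rw [div_pow, Real.sq_sqrt hp.le, hss]; field_simp; ring
      rw [this, hG]
      simp only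
      field_simp
      rw [hss]
    have hnn : ∀ u ∈ Ioo (√z) 1, 0 ≤ G u := fun u hu => by
      have hu0 : 0 < u := hs.trans hu.1
      positivity
    have hint : IntegrableOn G (Ioc (√z) 1) :=
      intervalIntegral.integrableOn_deriv_of_nonneg hcont hder hnn
    have hval : ∫ u in (√z)..1, G u = F 1 - F (√z) :=
      intervalIntegral.integral_eq_sub_of_hasDerivAt_of_le hs1.le hcont hder
        ((intervalIntegrable_iff_integrableOn_Ioc_of_le hs1.le).2 hint)
    have hstep : ∫⁻ u in Ioo (0:ℝ) 1, kerQ u z = ∫⁻ u in Ioo (√z) 1, ENNReal.ofReal (G u) := by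
      rw [← lintegral_indicator measurableSet_Ioo, ← lintegral_indicator measurableSet_Ioo]
      congr 1
      ext u
      by_cases hu : u ∈ Ioo (√z) 1
      · rw [indicator_of_mem hu, indicator_of_mem (show u ∈ Ioo (0:ℝ) 1 from ⟨hs.trans hu.1, hu.2⟩),
          kerQ, if_pos ⟨h0, by linarith [hlt u hu]⟩]
      · rw [indicator_of_notMem hu]
        by_cases hu' : u ∈ Ioo (0:ℝ) 1
        · rw [indicator_of_mem hu', kerQ, if_neg]
          rintro ⟨_, h⟩
          exact hu ⟨(Real.sqrt_lt' hu'.1).2 h, hu'.2⟩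
        · rw [indicator_of_notMem hu']
    rw [hstep, ← ofReal_integral_eq_lintegral_ofReal (hint.mono_set Ioo_subset_Ioc_self)
      ((ae_restrict_iff' measurableSet_Ioo).2 (Filter.Eventually.of_forall hnn)),
      ← integral_Ioc_eq_integral_Ioo, ← intervalIntegral.integral_of_le hs1.le, hval]
    simp [hF, d, indicator_of_mem hz, hss]



/-- If `U` and `V` are independent uniform random variables on `[0,1]`, then
`Q₀ = U²(1 − V²)` has density `d(z) = arctan(√(1−z)/√z)/(2√z)` on `(0,1)` with
respect to Lebesgue measure. -/
theorem density_of_Q0 {Ω : Type*} [MeasureSpace Ω] [IsProbabilityMeasure (ℙ : Measure Ω)]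
    (U V : Ω → ℝ) (hU : Measurable U) (hV : Measurable V)
    (hUV : IndepFun U V ℙ)
    (hUunif : Measure.map U ℙ = volume.restrict (Set.Icc (0 : ℝ) 1))
    (hVunif : Measure.map V ℙ = volume.restrict (Set.Icc (0 : ℝ) 1)) :
    Measure.map (fun ω => U ω ^ 2 * (1 - V ω ^ 2)) ℙ =
      volume.withDensity (fun z => ENNReal.ofReal (d z)) := by
  have hmap : Measure.map (fun ω => (U ω, V ω)) ℙ =
      (volume.restrict (Icc (0:ℝ) 1)).prod (volume.restrict (Icc (0:ℝ) 1)) := by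
    rw [(indepFun_iff_map_prod_eq_prod_map_map hU.aemeasurable hV.aemeasurable).1 hUV,
      hUunif, hVunif]
  have hg : Measurable fun p : ℝ × ℝ => p.1 ^ 2 * (1 - p.2 ^ 2) := by fun_prop
  have hcomp : Measure.map (fun ω => U ω ^ 2 * (1 - V ω ^ 2)) ℙ =
      Measure.map (fun p : ℝ × ℝ => p.1 ^ 2 * (1 - p.2 ^ 2))
        (Measure.map (fun ω => (U ω, V ω)) ℙ) := by
    rw [Measure.map_map hg (hU.prodMk hV)]; rfl
  rw [hcomp, hmap]
  ext S hS
  have hf : Measurable (S.indicator (1 : ℝ → ENNReal)) := measurable_one.indicator hS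
  have hfg : Measurable fun p : ℝ × ℝ =>
      S.indicator (1 : ℝ → ENNReal) (p.1 ^ 2 * (1 - p.2 ^ 2)) := hf.comp hg
  rw [← lintegral_indicator_one hS, lintegral_map hf hg,
    lintegral_prod _ hfg.aemeasurable, withDensity_apply _ hS,
    setLIntegral_congr (Ioo_ae_eq_Icc (a := (0:ℝ)) (b := 1)).symm]
  rw [setLIntegral_congr_fun measurableSet_Ioo (fun u hu => inner_v u hu _)]
  rw [lintegral_lintegral_swap
    (measurable_kerQ.mul (hf.comp measurable_snd)).aemeasurable]
  rw [← lintegral_indicator hS]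
  congr 1
  ext z
  rw [lintegral_mul_const _ (measurable_kerQ_left z),
    inner_u]
  by_cases hz : z ∈ S <;> simp [hz]
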